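/- Let n ≥ 3 and μ ∈ (0, n). Set γ₀ = (n(n−2) ∫_{ℝⁿ} (1+|x|²)^{−n} dx)^{−1/2} and U_{(a,λ)} = γ₀ δ_{(a,λ)} for a ∈ ℝⁿ, λ > 0. Let S̃ = (∫_{ℝⁿ}∫_{ℝⁿ} U_{(a,λ)}(x)^{2*_μ} U_{(a,λ)}(y)^{2*_μ} |x−y|^{−μ} dx dy)^{−1}. Then for every x ∈ ℝⁿ: −ΔU_{(a,λ)}(x) = S̃ · (∫_{ℝⁿ} U_{(a,λ)}(y)^{2*_μ} |x−y|^{−μ} dy) · U_{(a,λ)}(x)^{2*_μ − 1}. -/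

import Mathlib

open MeasureTheory

noncomputable section

/-- The standard bubble `δ_{(a,λ)}(x) = λ^{(n−2)/2}/(1+λ²|x−a|²)^{(n−2)/2}`. -/
def bubble (n : ℕ) (a : EuclideanSpace ℝ (Fin n)) (l : ℝ)
    (x : EuclideanSpace ℝ (Fin n)) : ℝ :=
  l ^ (((n : ℝ) - 2) / 2) / (1 + l ^ 2 * ‖x - a‖ ^ 2) ^ (((n : ℝ) - 2) / 2)

/-- The Laplacian of `f : ℝⁿ → ℝ` at `x`, as the sum of second directional derivatives
along the standard basis directions. -/
def lap {n : ℕ} (f : EuclideanSpace ℝ (Fin n) → ℝ) (x : EuclideanSpace ℝ (Fin n)) : ℝ :=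
  ∑ i : Fin n,
    fderiv ℝ (fun y => fderiv ℝ f y (EuclideanSpace.single i 1)) x (EuclideanSpace.single i 1)

/-- The normalization constant `γ₀ = (n(n−2)∫(1+|x|²)^{−n})^{−1/2}`. -/
def gamma0 (n : ℕ) : ℝ :=
  ((n : ℝ) * ((n : ℝ) - 2) *
      ∫ x : EuclideanSpace ℝ (Fin n), (1 + ‖x‖ ^ 2) ^ (-(n : ℝ))) ^ (-(1 / 2 : ℝ))

/-- The normalized bubble `U_{(a,λ)} = γ₀ δ_{(a,λ)}`. -/
def normBubble (n : ℕ) (a : EuclideanSpace ℝ (Fin n)) (l : ℝ)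
    (x : EuclideanSpace ℝ (Fin n)) : ℝ :=
  gamma0 n * bubble n a l x

/-- The reciprocal conformal weight of the bubble. -/
def bubbleWeight {n : ℕ} (a : EuclideanSpace ℝ (Fin n)) (l : ℝ) (x : EuclideanSpace ℝ (Fin n)) : ℝ :=
  l / (1 + l ^ 2 * ‖x - a‖ ^ 2)

lemma bubbleWeight_pos {n : ℕ} (a : EuclideanSpace ℝ (Fin n)) {l : ℝ} (hl : 0 < l)
    (x : EuclideanSpace ℝ (Fin n)) : 0 < bubbleWeight a l x := by
  unfold bubbleWeight; positivity

lemma bubbleWeight_self {n : ℕ} (a : EuclideanSpace ℝ (Fin n)) (l : ℝ) :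
    bubbleWeight a l a = l := by
  simp [bubbleWeight]

lemma continuous_bubbleWeight {n : ℕ} (a : EuclideanSpace ℝ (Fin n)) (l : ℝ) :
    Continuous (bubbleWeight a l) := by
  unfold bubbleWeight
  exact continuous_const.div (by fun_prop) fun x => by positivity

/-- Change of variables along an inversion. -/
lemma integral_inversion_eq {n : ℕ} (c : EuclideanSpace ℝ (Fin n)) {R : ℝ} (hR : R ≠ 0)
    (hn : n ≠ 0) (g : EuclideanSpace ℝ (Fin n) → ℝ) :
    ∫ y, g y = ∫ y, ((R / dist y c) ^ 2) ^ n * g (EuclideanGeometry.inversion c R y) := by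
  have : Nonempty (Fin n) := ⟨⟨0, Nat.pos_of_ne_zero hn⟩⟩
  have h := integral_image_eq_integral_abs_det_fderiv_smul volume
    (s := ({c}ᶜ : Set (EuclideanSpace ℝ (Fin n))))
    (MeasurableSet.singleton c).compl
    (fun x hx => (EuclideanGeometry.hasFDerivAt_inversion (R := R) hx).hasFDerivWithinAt)
    (EuclideanGeometry.inversion_injective c hR).injOn g
  have himg : EuclideanGeometry.inversion c R '' ({c}ᶜ : Set (EuclideanSpace ℝ (Fin n))) = {c}ᶜ := by
    rw [Set.image_compl_eq (EuclideanGeometry.inversion_bijective c hR)]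
    simp
  rw [himg, restrict_compl_singleton] at h
  rw [h]
  congr 1
  ext y
  rw [ContinuousLinearMap.det, ContinuousLinearMap.toLinearMap_smul, LinearMap.det_smul]
  change |_ * LinearMap.det (ℝ ∙ (y - c))ᗮ.reflection.toLinearMap| • _ = _
  rw [Submodule.det_reflection, abs_mul]
  simp

/-- The inversion centred at `c` with radius `√(λ⁻² + |c - a|²)` rescales the weight conformally. -/
lemma bubbleWeight_inversion {n : ℕ} (a c : EuclideanSpace ℝ (Fin n)) {l R : ℝ} (hl : 0 < l)
    (hR : R ^ 2 = (l ^ 2)⁻¹ + ‖c - a‖ ^ 2) {y : EuclideanSpace ℝ (Fin n)} (hy : y ≠ c) :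
    bubbleWeight a l (EuclideanGeometry.inversion c R y) * R ^ 2 =
      bubbleWeight a l y * dist y c ^ 2 := by
  have hd : 0 < ‖y - c‖ := norm_pos_iff.2 (sub_ne_zero.2 hy)
  have e1 : EuclideanGeometry.inversion c R y - a = (R / ‖y - c‖) ^ 2 • (y - c) + (c - a) := by
    simp [EuclideanGeometry.inversion, dist_eq_norm, add_sub_assoc]
  have e2 : y - a = (y - c) + (c - a) := by abel
  unfold bubbleWeight
  rw [e1, e2, norm_add_sq_real, norm_add_sq_real, norm_smul, inner_smul_left, dist_eq_norm]
  have hRpos : 0 < R ^ 2 := by rw [hR]; positivity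
  have p1 : 0 < 1 + l ^ 2 * ‖y - a‖ ^ 2 := by positivity
  have p2 : 0 < 1 + l ^ 2 * ‖EuclideanGeometry.inversion c R y - a‖ ^ 2 := by positivity
  rw [e2, norm_add_sq_real] at p1
  rw [e1, norm_add_sq_real, norm_smul, inner_smul_left] at p2
  simp only [Real.norm_eq_abs, abs_pow, sq_abs, RCLike.conj_to_real, abs_div, abs_norm,
    div_pow] at p2 ⊢
  set d := ‖y - c‖
  set t := inner ℝ (y - c) (c - a)
  have hR' : l ^ 2 * R ^ 2 = 1 + l ^ 2 * ‖c - a‖ ^ 2 := by rw [hR]; field_simp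
  have key : (1 + l ^ 2 * ((R ^ 2 / d ^ 2 * d) ^ 2 + 2 * (R ^ 2 / d ^ 2 * t) + ‖c - a‖ ^ 2)) * d ^ 2 =
      R ^ 2 * (1 + l ^ 2 * (d ^ 2 + 2 * t + ‖c - a‖ ^ 2)) := by
    field_simp
    linear_combination (R ^ 2 - d ^ 2) * hR'
  rw [div_mul_eq_mul_div l _ (d ^ 2), div_mul_eq_mul_div l _ (R ^ 2), div_eq_div_iff p2.ne' p1.ne']
  linear_combination -l * key

lemma exists_inversion_swap {n : ℕ} (a x : EuclideanSpace ℝ (Fin n)) {l : ℝ} (hl : 0 < l)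
    (hx : x ≠ a) : ∃ (c : EuclideanSpace ℝ (Fin n)) (R : ℝ), R ≠ 0 ∧
      R ^ 2 = (l ^ 2)⁻¹ + ‖c - a‖ ^ 2 ∧ x ≠ c ∧ EuclideanGeometry.inversion c R x = a := by
  have hd : 0 < ‖x - a‖ := norm_pos_iff.2 (sub_ne_zero.2 hx)
  set t := (l ^ 2 * ‖x - a‖ ^ 2)⁻¹ with ht
  have htp : 0 < t := by positivity
  have hc : ‖(a - t • (x - a)) - a‖ ^ 2 = t ^ 2 * ‖x - a‖ ^ 2 := by
    rw [sub_sub_cancel_left, norm_neg, norm_smul, mul_pow, Real.norm_eq_abs, sq_abs]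
  have hxc : x - (a - t • (x - a)) = (1 + t) • (x - a) := by module
  have hpos : 0 < (l ^ 2)⁻¹ + ‖(a - t • (x - a)) - a‖ ^ 2 := by positivity
  refine ⟨a - t • (x - a), √((l ^ 2)⁻¹ + ‖(a - t • (x - a)) - a‖ ^ 2),
    (Real.sqrt_pos.2 hpos).ne', Real.sq_sqrt hpos.le, ?_, ?_⟩
  · rw [← sub_ne_zero, hxc]
    exact smul_ne_zero (by positivity) (sub_ne_zero.2 hx)
  · rw [EuclideanGeometry.inversion, div_pow, Real.sq_sqrt hpos.le, dist_eq_norm, vsub_eq_sub,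
      vadd_eq_add, hxc, hc, norm_smul, mul_pow, Real.norm_eq_abs, sq_abs, smul_smul]
    have : ((l ^ 2)⁻¹ + t ^ 2 * ‖x - a‖ ^ 2) / ((1 + t) ^ 2 * ‖x - a‖ ^ 2) * (1 + t) = t := by
      have : (l ^ 2)⁻¹ = t * ‖x - a‖ ^ 2 := by rw [ht]; field_simp
      rw [this]
      field_simp
    rw [this]
    module

/-- Conformal covariance of the Riesz potential of a bubble power. -/
lemma integral_bubbleWeight_riesz {n : ℕ} (hn : n ≠ 0) (μ : ℝ) (a x : EuclideanSpace ℝ (Fin n))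
    {l : ℝ} (hl : 0 < l) :
    ∫ y, bubbleWeight a l y ^ ((2 * (n : ℝ) - μ) / 2) * ‖x - y‖ ^ (-μ) =
      (bubbleWeight a l x / l) ^ (μ / 2) *
        ∫ y, bubbleWeight a l y ^ ((2 * (n : ℝ) - μ) / 2) * ‖a - y‖ ^ (-μ) := by
  have : Nonempty (Fin n) := ⟨⟨0, Nat.pos_of_ne_zero hn⟩⟩
  rcases eq_or_ne x a with rfl | hx
  · simp [bubbleWeight_self, hl.ne']
  obtain ⟨c, R, hR0, hR, hxc, hσ⟩ := exists_inversion_swap a x hl hx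
  have hWx := bubbleWeight_pos a hl x
  rw [integral_inversion_eq c hR0 hn fun y =>
    bubbleWeight a l y ^ ((2 * (n : ℝ) - μ) / 2) * ‖a - y‖ ^ (-μ), ← integral_const_mul]
  refine (integral_congr_ae ?_).symm
  filter_upwards [compl_mem_ae_iff.2 (measure_singleton c)] with y hy
  have hyc : y ≠ c := hy
  have hWy := bubbleWeight_pos a hl y
  have hdx := dist_pos.2 hxc
  have hdy := dist_pos.2 hyc
  have hRp : 0 < R ^ 2 := by positivity
  set u := (R / dist y c) ^ 2 with hu
  have hup : 0 < u := by positivity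
  have h1 : bubbleWeight a l (EuclideanGeometry.inversion c R y) = bubbleWeight a l y * u⁻¹ := by
    have := bubbleWeight_inversion a c hl hR hyc
    rw [hu]; field_simp; linarith
  set v := (R / dist x c) ^ 2 with hv
  have h2 : bubbleWeight a l x / l = v := by
    have := bubbleWeight_inversion a c hl hR hxc
    rw [hσ, bubbleWeight_self] at this
    rw [hv]; field_simp; linarith
  have hvp : 0 < v := by positivity
  have h3 : ‖a - EuclideanGeometry.inversion c R y‖ ^ (-μ) =
      (u ^ (-μ / 2) * v ^ (-μ / 2)) * ‖x - y‖ ^ (-μ) := by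
    have e : ‖a - EuclideanGeometry.inversion c R y‖ ^ 2 = u * v * ‖x - y‖ ^ 2 := by
      rw [← dist_eq_norm, ← dist_eq_norm, ← hσ, EuclideanGeometry.dist_inversion_inversion hxc hyc,
        hu, hv]
      field_simp
    have half : ∀ t : ℝ, 0 ≤ t → t ^ (-μ) = (t ^ 2) ^ (-μ / 2) := fun t ht => by
      rw [← Real.rpow_natCast, ← Real.rpow_mul ht]; congr 1; push_cast; ring
    rw [half _ (norm_nonneg _), half _ (norm_nonneg _), e, Real.mul_rpow (by positivity)
      (by positivity), Real.mul_rpow hup.le hvp.le]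
  have hu1 : u ^ n * ((u⁻¹) ^ ((2 * (n : ℝ) - μ) / 2) * u ^ (-μ / 2)) = 1 := by
    rw [Real.inv_rpow hup.le, ← Real.rpow_neg hup.le, ← Real.rpow_natCast, ← Real.rpow_add hup,
      ← Real.rpow_add hup, ← Real.rpow_zero u]
    congr 1; ring
  have hv1 : v ^ (μ / 2) * v ^ (-μ / 2) = 1 := by
    rw [← Real.rpow_add hvp, ← Real.rpow_zero v]; congr 1; ring
  simp only [h1, h2, h3, Real.mul_rpow hWy.le (inv_pos.2 hup).le]
  linear_combination bubbleWeight a l y ^ ((2 * (n : ℝ) - μ) / 2) * ‖x - y‖ ^ (-μ) *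
    (v ^ (μ / 2) * v ^ (-μ / 2) * hu1 + hv1)

lemma integral_bubbleWeight_pow {n : ℕ} (a : EuclideanSpace ℝ (Fin n)) {l : ℝ} (hl : 0 < l) :
    ∫ x, bubbleWeight a l x ^ (n : ℝ) =
      ∫ x : EuclideanSpace ℝ (Fin n), (1 + ‖x‖ ^ 2) ^ (-(n : ℝ)) := by
  have h := Measure.integral_comp_smul (volume : Measure (EuclideanSpace ℝ (Fin n)))
    (fun x => (1 + ‖x‖ ^ 2) ^ (-(n : ℝ))) l
  have h2 := integral_sub_right_eq_self (μ := (volume : Measure (EuclideanSpace ℝ (Fin n))))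
    (fun x => (1 + ‖l • x‖ ^ 2) ^ (-(n : ℝ))) a
  rw [finrank_euclideanSpace_fin, abs_of_pos (by positivity), smul_eq_mul] at h
  rw [h] at h2
  rw [eq_inv_mul_iff_mul_eq₀ (by positivity), ← integral_const_mul] at h2
  rw [← h2]
  congr 1
  ext x
  unfold bubbleWeight
  rw [Real.div_rpow hl.le (by positivity), norm_smul, mul_pow, Real.norm_eq_abs, sq_abs,
    Real.rpow_neg (by positivity), Real.rpow_natCast, div_eq_mul_inv]

lemma integral_one_add_norm_sq_rpow_pos {n : ℕ} (hn : n ≠ 0) :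
    0 < ∫ x : EuclideanSpace ℝ (Fin n), (1 + ‖x‖ ^ 2) ^ (-(n : ℝ)) := by
  have hi : Integrable (fun x : EuclideanSpace ℝ (Fin n) => (1 + ‖x‖ ^ 2) ^ (-(n : ℝ))) := by
    have hnp : 0 < (n : ℝ) := by positivity
    have := integrable_rpow_neg_one_add_norm_sq (E := EuclideanSpace ℝ (Fin n)) (μ := volume)
      (r := 2 * n) (by rw [finrank_euclideanSpace_fin]; linarith)
    convert this using 3
    ring
  refine (integral_pos_iff_support_of_nonneg (fun x => by positivity) hi).2 ?_
  have : Function.support (fun x : EuclideanSpace ℝ (Fin n) => (1 + ‖x‖ ^ 2) ^ (-(n : ℝ))) =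
      Set.univ := by
    ext x; simp only [Function.mem_support, Set.mem_univ, iff_true]; positivity
  rw [this]
  exact Measure.measure_univ_pos.2 (NeZero.ne _)

lemma integrable_bubbleWeight_riesz_center {n : ℕ} (hn : n ≠ 0) {μ : ℝ} (hμn : μ < n)
    (a : EuclideanSpace ℝ (Fin n)) {l : ℝ} (hl : 0 < l) :
    Integrable fun y => bubbleWeight a l y ^ ((2 * (n : ℝ) - μ) / 2) * ‖a - y‖ ^ (-μ) := by
  have : Nonempty (Fin n) := ⟨⟨0, Nat.pos_of_ne_zero hn⟩⟩
  have hs : 0 < (2 * (n : ℝ) - μ) / 2 := by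
    have : 0 < (n : ℝ) := by positivity
    linarith
  set s := (2 * (n : ℝ) - μ) / 2 with hs'
  have key : Integrable fun z : EuclideanSpace ℝ (Fin n) =>
      (fun r : ℝ => (l / (1 + l ^ 2 * r ^ 2)) ^ s * r ^ (-μ)) ‖z‖ := by
    refine (integrable_fun_norm_addHaar volume
      (f := fun r : ℝ => (l / (1 + l ^ 2 * r ^ 2)) ^ s * r ^ (-μ))).2 ?_
    rw [finrank_euclideanSpace_fin]
    have meas : Measurable fun r : ℝ =>
        r ^ (n - 1) • ((l / (1 + l ^ 2 * r ^ 2)) ^ s * r ^ (-μ)) := by fun_prop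
    have hpow : ∀ r : ℝ, 0 < r → r ^ (n - 1) * r ^ (-μ) = r ^ ((n : ℝ) - 1 - μ) := fun r hr => by
      rw [← Real.rpow_natCast, ← Real.rpow_add hr, Nat.cast_sub (Nat.pos_of_ne_zero hn)]
      congr 1; push_cast; ring
    rw [← Set.Ioo_union_Ici_eq_Ioi zero_lt_one, integrableOn_union]
    constructor
    · have hI : IntegrableOn (fun r : ℝ => l ^ s * r ^ ((n : ℝ) - 1 - μ)) (Set.Ioo 0 1) :=
        ((intervalIntegral.integrableOn_Ioo_rpow_iff zero_lt_one).2 (by linarith)).const_mul _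
      refine hI.mono' meas.aestronglyMeasurable ?_
      filter_upwards [ae_restrict_mem measurableSet_Ioo] with r hr
      have hr0 : 0 < r := hr.1
      rw [Real.norm_of_nonneg (by positivity), smul_eq_mul, ← hpow r hr0, mul_left_comm]
      gcongr
      exact div_le_self hl.le (by nlinarith [sq_nonneg (l * r)])
    · have hI : IntegrableOn (fun r : ℝ => (l⁻¹) ^ s * r ^ (-(n : ℝ) - 1)) (Set.Ici 1) := by
        rw [integrableOn_Ici_iff_integrableOn_Ioi]
        refine (integrableOn_Ioi_rpow_of_lt ?_ zero_lt_one).const_mul _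
        have : 0 < (n : ℝ) := by positivity
        linarith
      refine hI.mono' meas.aestronglyMeasurable ?_
      filter_upwards [ae_restrict_mem measurableSet_Ici] with r hr
      have hr0 : 0 < r := zero_lt_one.trans_le hr
      rw [Real.norm_of_nonneg (by positivity), smul_eq_mul]
      have e : (l⁻¹) ^ s * r ^ (-(n : ℝ) - 1) = r ^ (n - 1) * ((l⁻¹ * (r ^ 2)⁻¹) ^ s * r ^ (-μ)) := by
        have e1 : ((r ^ 2)⁻¹) ^ s = r ^ (-2 * s) := by
          rw [← Real.rpow_natCast, ← Real.rpow_neg hr0.le, ← Real.rpow_mul hr0.le]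
          norm_num
        rw [Real.mul_rpow (by positivity) (by positivity), e1, mul_assoc, mul_left_comm,
          mul_left_comm (r ^ (n - 1)), hpow r hr0, ← Real.rpow_add hr0]
        congr 2
        rw [hs']; ring
      rw [e]
      gcongr
      rw [div_le_iff₀ (by positivity)]
      field_simp
      nlinarith [sq_nonneg (l * r)]
  have := key.comp_sub_left a
  refine this.congr (Filter.Eventually.of_forall fun y => ?_)
  simp only [bubbleWeight, norm_sub_rev a y]

lemma integral_bubbleWeight_riesz_center_pos {n : ℕ} (hn : n ≠ 0) {μ : ℝ} (hμn : μ < n)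
    (a : EuclideanSpace ℝ (Fin n)) {l : ℝ} (hl : 0 < l) :
    0 < ∫ y, bubbleWeight a l y ^ ((2 * (n : ℝ) - μ) / 2) * ‖a - y‖ ^ (-μ) := by
  have : Nonempty (Fin n) := ⟨⟨0, Nat.pos_of_ne_zero hn⟩⟩
  have hW := bubbleWeight_pos a hl
  refine (integral_pos_iff_support_of_nonneg (fun x => ?_)
    (integrable_bubbleWeight_riesz_center hn hμn a hl)).2 ?_
  · have := hW x
    positivity
  · have hsub : ({a}ᶜ : Set (EuclideanSpace ℝ (Fin n))) ⊆ Function.support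
        (fun y => bubbleWeight a l y ^ ((2 * (n : ℝ) - μ) / 2) * ‖a - y‖ ^ (-μ)) := fun y hy => by
      have := hW y
      have h2 : 0 < ‖a - y‖ := norm_pos_iff.2 (sub_ne_zero.2 (Ne.symm hy))
      simp only [Function.mem_support]
      positivity
    refine lt_of_lt_of_le ?_ (measure_mono hsub)
    exact isOpen_compl_singleton.measure_pos _ (Set.nonempty_compl_of_nontrivial a)

lemma hasFDerivAt_one_add_rpow {n : ℕ} (a : EuclideanSpace ℝ (Fin n)) (l s : ℝ)
    (x : EuclideanSpace ℝ (Fin n)) :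
    HasFDerivAt (fun y => (1 + l ^ 2 * ‖y - a‖ ^ 2) ^ s)
      ((s * (1 + l ^ 2 * ‖x - a‖ ^ 2) ^ (s - 1) * (2 * l ^ 2)) • innerSL ℝ (x - a)) x := by
  have h := ((((hasFDerivAt_id (𝕜 := ℝ) x).sub_const a).norm_sq.const_mul (l ^ 2)).const_add
    1).rpow_const (p := s) (Or.inl (by positivity : (1 + l ^ 2 * ‖x - a‖ ^ 2) ≠ 0))
  refine h.congr_fderiv ?_
  ext v
  simp
  ring

lemma lap_const_mul_one_add_rpow {n : ℕ} (a : EuclideanSpace ℝ (Fin n)) (l s C : ℝ)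
    (x : EuclideanSpace ℝ (Fin n)) :
    lap (fun y => C * (1 + l ^ 2 * ‖y - a‖ ^ 2) ^ s) x =
      C * (2 * s * l ^ 2) * (2 * l ^ 2 * (s - 1) * (1 + l ^ 2 * ‖x - a‖ ^ 2) ^ (s - 2) *
        ‖x - a‖ ^ 2 + n * (1 + l ^ 2 * ‖x - a‖ ^ 2) ^ (s - 1)) := by
  have h1 : ∀ (i : Fin n) y, fderiv ℝ (fun y => C * (1 + l ^ 2 * ‖y - a‖ ^ 2) ^ s) y
      (EuclideanSpace.single i 1) =
      C * (2 * s * l ^ 2) * ((1 + l ^ 2 * ‖y - a‖ ^ 2) ^ (s - 1) * (y - a) i) := fun i y => by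
    rw [((hasFDerivAt_one_add_rpow a l s y).const_mul C).fderiv]
    simp [EuclideanSpace.inner_single_right]
    ring
  have h2 : ∀ i : Fin n, fderiv ℝ (fun y : EuclideanSpace ℝ (Fin n) =>
      C * (2 * s * l ^ 2) * ((1 + l ^ 2 * ‖y - a‖ ^ 2) ^ (s - 1) * (y - a) i)) x
      (EuclideanSpace.single i 1) =
      C * (2 * s * l ^ 2) * (2 * l ^ 2 * (s - 1) * (1 + l ^ 2 * ‖x - a‖ ^ 2) ^ (s - 2) *
        (x - a) i ^ 2 + (1 + l ^ 2 * ‖x - a‖ ^ 2) ^ (s - 1)) := fun i => by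
    have hc : HasFDerivAt (fun y : EuclideanSpace ℝ (Fin n) => (y - a) i)
        (EuclideanSpace.proj i : EuclideanSpace ℝ (Fin n) →L[ℝ] ℝ) x := by
      have := (EuclideanSpace.proj i : EuclideanSpace ℝ (Fin n) →L[ℝ] ℝ).hasFDerivAt (x := x)
      exact this.sub_const (a i)
    have h := ((hasFDerivAt_one_add_rpow a l (s - 1) x).mul hc).const_mul (C * (2 * s * l ^ 2))
    rw [show s - 1 - 1 = s - 2 by ring] at h
    refine (DFunLike.congr_fun h.fderiv _).trans ?_
    simp [EuclideanSpace.inner_single_right]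
    ring
  unfold lap
  simp only [h1, h2]
  rw [← Finset.mul_sum, Finset.sum_add_distrib, ← Finset.mul_sum, ← EuclideanSpace.real_norm_sq_eq]
  simp

lemma bubble_eq_bubbleWeight_rpow (n : ℕ) (a : EuclideanSpace ℝ (Fin n)) {l : ℝ} (hl : 0 < l)
    (x : EuclideanSpace ℝ (Fin n)) :
    bubble n a l x = bubbleWeight a l x ^ (((n : ℝ) - 2) / 2) := by
  rw [bubble, bubbleWeight, Real.div_rpow hl.le (by positivity)]

lemma lap_normBubble (n : ℕ) (a : EuclideanSpace ℝ (Fin n)) {l : ℝ} (hl : 0 < l)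
    (x : EuclideanSpace ℝ (Fin n)) :
    -lap (normBubble n a l) x =
      gamma0 n * (n * (n - 2)) * bubbleWeight a l x ^ (((n : ℝ) + 2) / 2) := by
  have e : normBubble n a l = fun y => (gamma0 n * l ^ (((n : ℝ) - 2) / 2)) *
      (1 + l ^ 2 * ‖y - a‖ ^ 2) ^ (-(((n : ℝ) - 2) / 2)) := by
    ext y
    rw [normBubble, bubble, Real.rpow_neg (by positivity)]
    ring
  have hw : 0 < 1 + l ^ 2 * ‖x - a‖ ^ 2 := by positivity
  rw [e, lap_const_mul_one_add_rpow, bubbleWeight, Real.div_rpow hl.le hw.le]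
  have e1 : (1 + l ^ 2 * ‖x - a‖ ^ 2) ^ (-(((n : ℝ) - 2) / 2) - 2) =
      ((1 + l ^ 2 * ‖x - a‖ ^ 2) ^ (((n : ℝ) + 2) / 2))⁻¹ := by
    rw [← Real.rpow_neg hw.le]; congr 1; ring
  have e1' : (1 + l ^ 2 * ‖x - a‖ ^ 2) ^ (-(((n : ℝ) - 2) / 2) - 1) =
      ((1 + l ^ 2 * ‖x - a‖ ^ 2) ^ (((n : ℝ) + 2) / 2))⁻¹ * (1 + l ^ 2 * ‖x - a‖ ^ 2) := by
    rw [← Real.rpow_neg hw.le, ← Real.rpow_add_one hw.ne']; congr 1; ring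
  have e2 : l ^ (((n : ℝ) + 2) / 2) = l ^ (((n : ℝ) - 2) / 2) * l ^ 2 := by
    rw [← Real.rpow_natCast, ← Real.rpow_add hl]; congr 1; push_cast; ring
  rw [e1, e1', e2]
  ring

/-- The normalized bubble `U_{(a,λ)}` satisfies
`−ΔU = S̃ (∫ U^{2*_μ}(y)|x−y|^{−μ} dy) U^{2*_μ−1}`, where
`S̃ = (∫∫ U^{2*_μ}(x) U^{2*_μ}(y) |x−y|^{−μ})⁻¹`. -/
theorem normBubble_pde (n : ℕ) (hn : 3 ≤ n) (μ : ℝ) (hμ0 : 0 < μ) (hμn : μ < n)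
    (a : EuclideanSpace ℝ (Fin n)) (l : ℝ) (hl : 0 < l) :
    ∀ x : EuclideanSpace ℝ (Fin n),
      -lap (normBubble n a l) x =
        (∫ x' : EuclideanSpace ℝ (Fin n), ∫ y : EuclideanSpace ℝ (Fin n),
            normBubble n a l x' ^ ((2 * (n : ℝ) - μ) / ((n : ℝ) - 2)) *
              normBubble n a l y ^ ((2 * (n : ℝ) - μ) / ((n : ℝ) - 2)) *
              ‖x' - y‖ ^ (-μ))⁻¹ *
          (∫ y, normBubble n a l y ^ ((2 * (n : ℝ) - μ) / ((n : ℝ) - 2)) * ‖x - y‖ ^ (-μ)) *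
          normBubble n a l x ^ ((2 * (n : ℝ) - μ) / ((n : ℝ) - 2) - 1) := by
  intro x
  have hn3 : (3 : ℝ) ≤ n := by exact_mod_cast hn
  have hn0 : n ≠ 0 := by lia
  have hn2 : (n : ℝ) - 2 ≠ 0 := by linarith
  have hI := integral_one_add_norm_sq_rpow_pos hn0
  have hW := bubbleWeight_pos a hl
  have hJ := integral_bubbleWeight_pow a hl
  have hK := integral_bubbleWeight_riesz_center_pos hn0 hμn a hl
  have hconv := fun z => integral_bubbleWeight_riesz hn0 μ a z hl
  have hbase : 0 < (n : ℝ) * ((n : ℝ) - 2) *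
      ∫ x : EuclideanSpace ℝ (Fin n), (1 + ‖x‖ ^ 2) ^ (-(n : ℝ)) :=
    mul_pos (mul_pos (by linarith) (by linarith)) hI
  have hγ : 0 < gamma0 n := Real.rpow_pos_of_pos hbase _
  have hγ2 : gamma0 n ^ 2 * ((n : ℝ) * ((n : ℝ) - 2) *
      ∫ x : EuclideanSpace ℝ (Fin n), (1 + ‖x‖ ^ 2) ^ (-(n : ℝ))) = 1 := by
    rw [gamma0, ← Real.rpow_natCast, ← Real.rpow_mul hbase.le, ← Real.rpow_add_one hbase.ne']
    norm_num
  have hU : ∀ q z, normBubble n a l z ^ q =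
      gamma0 n ^ q * bubbleWeight a l z ^ (((n : ℝ) - 2) / 2 * q) := fun q z => by
    rw [normBubble, bubble_eq_bubbleWeight_rpow n a hl,
      Real.mul_rpow hγ.le (Real.rpow_nonneg (hW z).le _), ← Real.rpow_mul (hW z).le]
  rw [lap_normBubble n a hl]
  simp only [hU]
  set p := (2 * (n : ℝ) - μ) / ((n : ℝ) - 2) with hp
  have ep : ((n : ℝ) - 2) / 2 * p = (2 * (n : ℝ) - μ) / 2 := by rw [hp]; field_simp
  have ep' : ((n : ℝ) - 2) / 2 * (p - 1) =
      (2 * (n : ℝ) - μ) / 2 - ((n : ℝ) - 2) / 2 * 1 := by rw [mul_sub, ep]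
  rw [ep, ep', Real.rpow_sub_one hγ.ne']
  set K := ∫ y, bubbleWeight a l y ^ ((2 * (n : ℝ) - μ) / 2) * ‖a - y‖ ^ (-μ)
  set I := ∫ x : EuclideanSpace ℝ (Fin n), (1 + ‖x‖ ^ 2) ^ (-(n : ℝ))
  set g := gamma0 n ^ p
  have hg : 0 < g := Real.rpow_pos_of_pos hγ _
  have hinner : ∀ z, ∫ y, g * bubbleWeight a l y ^ ((2 * (n : ℝ) - μ) / 2) * ‖z - y‖ ^ (-μ) =
      g * (l ^ (-(μ / 2)) * K) * bubbleWeight a l z ^ (μ / 2) := fun z => by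
    simp only [mul_assoc g]
    rw [integral_const_mul, hconv, Real.div_rpow (hW z).le hl.le, Real.rpow_neg hl.le]
    ring
  have hdouble : (∫ z, ∫ y, g * bubbleWeight a l z ^ ((2 * (n : ℝ) - μ) / 2) *
      (g * bubbleWeight a l y ^ ((2 * (n : ℝ) - μ) / 2)) * ‖z - y‖ ^ (-μ)) =
      g * (g * (l ^ (-(μ / 2)) * K)) * I := by
    rw [← hJ, ← integral_const_mul]
    congr 1
    ext z
    simp only [mul_assoc (g * bubbleWeight a l z ^ ((2 * (n : ℝ) - μ) / 2))]
    rw [integral_const_mul, hinner]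
    have : bubbleWeight a l z ^ (n : ℝ) =
        bubbleWeight a l z ^ ((2 * (n : ℝ) - μ) / 2) * bubbleWeight a l z ^ (μ / 2) := by
      rw [← Real.rpow_add (hW z)]; congr 1; ring
    rw [this]
    ring
  rw [hdouble, hinner]
  have eW : bubbleWeight a l x ^ (((n : ℝ) + 2) / 2) = bubbleWeight a l x ^ (μ / 2) *
      bubbleWeight a l x ^ ((2 * (n : ℝ) - μ) / 2 - ((n : ℝ) - 2) / 2 * 1) := by
    rw [← Real.rpow_add (hW x)]; congr 1; ring
  rw [eW]
  have hL : 0 < l ^ (-(μ / 2)) := Real.rpow_pos_of_pos hl _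
  generalize bubbleWeight a l x ^ (μ / 2) = X
  generalize bubbleWeight a l x ^ ((2 * (n : ℝ) - μ) / 2 - ((n : ℝ) - 2) / 2 * 1) = Y
  field_simp
  linear_combination X * Y * hγ2
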